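/- arXiv:1901.02343 — 12 statements merged into one kernel-verified Lean document; each statement's English description precedes it below -/
import Mathlib

section
/- For all integers j, k, m and s, F_s·F_m·F_{m−s}·G_{j+k}² = F_{m−s}·F_{m−k}·F_{s−k}·G_j² + (−1)^{s+k}·F_k·F_m·F_{m−k}·G_{j+s}² − (−1)^{s+k}·F_k·F_s·F_{s−k}·G_{j+m}². -/
/-- The addition formula for a Fibonacci-like sequence `G`. -/
theorem fibLike_add {F G : ℤ → ℤ} (hF0 : F 0 = 0) (hF1 : F 1 = 1)
    (hF : ∀ j : ℤ, F j = F (j - 1) + F (j - 2))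
    (hG : ∀ j : ℤ, G j = G (j - 1) + G (j - 2)) (j n : ℤ) :
    G (j + n) = G j * F (n - 1) + G (j + 1) * F n := by
  have key : ∀ n : ℤ, G (j + n) = G j * F (n - 1) + G (j + 1) * F n ∧
      G (j + (n + 1)) = G j * F n + G (j + 1) * F (n + 1) := by
    intro n
    induction n using Int.induction_on with
    | zero =>
      have h : F (-1) = 1 := by
        have h1 := hF 1
        norm_num only [hF0, hF1] at h1
        linarith
      simp [hF0, hF1, h]
    | succ i ih =>
      have h1 := hF (i + 1)
      have h2 := hF (i + 1 + 1)
      have h3 := hG (j + (i + 1 + 1))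
      ring_nf at *
      refine ⟨ih.2, ?_⟩
      rw [h3, h2, ih.1, ih.2, h1]
      ring
    | pred i ih =>
      have h1 := hF (-i)
      have h2 := hF (-i + 1)
      have h3 := hG (j + (-i + 1))
      ring_nf at *
      refine ⟨?_, ih.1⟩
      linear_combination ih.2 - ih.1 - h3 + G j * h1 + G (1 + j) * h2
  exact (key n).1

/-- The identity of Ocagne, for integer indices. -/
theorem fib_sub_eq_negOnePow_mul {F : ℤ → ℤ} (hF0 : F 0 = 0) (hF1 : F 1 = 1)
    (hF : ∀ j : ℤ, F j = F (j - 1) + F (j - 2)) (m s : ℤ) :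
    F (m - s) = (s.negOnePow : ℤ) * (F m * F (s - 1) - F (m - 1) * F s) := by
  have key : ∀ s : ℤ,
      F (m - s) = (s.negOnePow : ℤ) * (F m * F (s - 1) - F (m - 1) * F s) ∧
      F (m - (s + 1)) = -(s.negOnePow : ℤ) * (F m * F s - F (m - 1) * F (s + 1)) := by
    intro s
    induction s using Int.induction_on with
    | zero =>
      have h : F (-1) = 1 := by
        have h1 := hF 1
        norm_num only [hF0, hF1] at h1
        linarith
      simp [hF0, hF1, h]
    | succ i ih =>
      have h1 := hF (i + 1)
      have h2 := hF (i + 1 + 1)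
      have h3 := hF (m - i)
      rw [Int.negOnePow_succ]
      push_cast
      ring_nf at *
      refine ⟨by linear_combination ih.2, ?_⟩
      linear_combination ih.1 - ih.2 - h3 - (Int.negOnePow i : ℤ) * (F m * h1 - F (-1 + m) * h2)
    | pred i ih =>
      have h1 := hF (-i)
      have h2 := hF (-i + 1)
      have h3 := hF (m - (-i - 1))
      rw [Int.negOnePow_sub, Int.negOnePow_one]
      push_cast
      ring_nf at *
      refine ⟨?_, by linear_combination ih.1⟩
      linear_combination h3 + ih.1 + ih.2 -
        (Int.negOnePow (-i) : ℤ) * (F m * h1 - F (-1 + m) * h2)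
  exact (key s).1

/-- Theorem 1 (main identity): for all integers `j`, `k`, `m`, `s`,
`F_s F_m F_{m-s} G_{j+k}² = F_{m-s} F_{m-k} F_{s-k} G_j²
  + (-1)^{s+k} F_k F_m F_{m-k} G_{j+s}² - (-1)^{s+k} F_k F_s F_{s-k} G_{j+m}²`,
where `F` is the (integer-indexed) Fibonacci sequence and `G` is any
Fibonacci-like sequence. -/
theorem stmt_0 (F G : ℤ → ℤ)
    (hF0 : F 0 = 0) (hF1 : F 1 = 1)
    (hF : ∀ j : ℤ, F j = F (j - 1) + F (j - 2))
    (hG : ∀ j : ℤ, G j = G (j - 1) + G (j - 2))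
    (j k m s : ℤ) :
    F s * F m * F (m - s) * G (j + k) ^ 2 =
      F (m - s) * F (m - k) * F (s - k) * G j ^ 2
      + (-1 : ℤ) ^ (s + k).natAbs * (F k * F m * F (m - k) * G (j + s) ^ 2)
      - (-1 : ℤ) ^ (s + k).natAbs * (F k * F s * F (s - k) * G (j + m) ^ 2) := by
  have hsign : (-1 : ℤ) ^ (s + k).natAbs = (s.negOnePow : ℤ) * (k.negOnePow : ℤ) := by
    rw [← Units.val_mul, ← Int.negOnePow_add, ← Int.coe_negOnePow_natCast, Int.natCast_natAbs,
      Int.negOnePow_abs]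
  have hsq : (k.negOnePow : ℤ) * (k.negOnePow : ℤ) = 1 := by
    rw [← Units.val_mul, Int.units_mul_self, Units.val_one]
  rw [hsign, fib_sub_eq_negOnePow_mul hF0 hF1 hF m s, fib_sub_eq_negOnePow_mul hF0 hF1 hF m k,
    fib_sub_eq_negOnePow_mul hF0 hF1 hF s k, fibLike_add hF0 hF1 hF hG j k,
    fibLike_add hF0 hF1 hF hG j s, fibLike_add hF0 hF1 hF hG j m]
  linear_combination (-(s.negOnePow : ℤ) * (F s * F m * (F m * F (s - 1) - F (m - 1) * F s) *
    (G j * F (k - 1) + G (j + 1) * F k) ^ 2)) * hsq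
end

section
/- For all integers j, k and s, 2·F_s·F_k·G_{j+k}·G_{j+s} = F_s²·G_{j+k}² + F_k²·G_{j+s}² − F_{s−k}²·G_j². -/
/-- A Fibonacci-like sequence is determined by two consecutive terms through the Fibonacci numbers:
`G_{j+k} = F_k G_{j+1} + F_{k-1} G_j`. -/
theorem fibonacciLike_add (F G : ℤ → ℤ)
    (hF0 : F 0 = 0) (hF1 : F 1 = 1)
    (hF : ∀ j : ℤ, F j = F (j - 1) + F (j - 2))
    (hG : ∀ j : ℤ, G j = G (j - 1) + G (j - 2)) (j k : ℤ) :
    G (j + k) = F k * G (j + 1) + F (k - 1) * G j := by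
  have hF' (i : ℤ) : F (i + 1) = F i + F (i - 1) := by
    have h := hF (i + 1)
    rwa [show i + 1 - 1 = i by ring, show i + 1 - 2 = i - 1 by ring] at h
  have hG' (i : ℤ) : G (i + 1) = G i + G (i - 1) := by
    have h := hG (i + 1)
    rwa [show i + 1 - 1 = i by ring, show i + 1 - 2 = i - 1 by ring] at h
  suffices h : G (j + k) = F k * G (j + 1) + F (k - 1) * G j ∧
      G (j + k + 1) = F (k + 1) * G (j + 1) + F k * G j from h.1
  induction k using Int.induction_on with
  | zero =>
    have h := hF' 0
    rw [zero_add, hF0, hF1, zero_add, zero_sub] at h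
    simp [hF0, hF1, ← h]
  | succ i ih =>
    obtain ⟨h₀, h₁⟩ := ih
    have hg := hG' (j + i + 1)
    have hf := hF' (i + 1)
    have hf' := hF' i
    rw [add_sub_cancel_right] at hg hf
    rw [← add_assoc, add_sub_cancel_right]
    refine ⟨h₁, ?_⟩
    rw [hg, hf, h₀, h₁, hf']
    ring
  | pred i ih =>
    obtain ⟨h₀, h₁⟩ := ih
    have hg := hG' (j + -i)
    have hf := hF' (-i)
    have hf' := hF' (-i - 1)
    rw [sub_add_cancel] at hf'
    rw [← add_sub_assoc, sub_add_cancel, sub_add_cancel]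
    refine ⟨?_, h₀⟩
    linear_combination h₁ - h₀ - hg + G j * hf' + G (j + 1) * hf

/-- The square of Cassini's identity, for all integer indices. -/
theorem fibonacci_cassini_sq (F : ℤ → ℤ)
    (hF0 : F 0 = 0) (hF1 : F 1 = 1)
    (hF : ∀ j : ℤ, F j = F (j - 1) + F (j - 2)) (k : ℤ) :
    (F (k + 1) * F (k - 1) - F k ^ 2) ^ 2 = 1 := by
  have hF' (i : ℤ) : F (i + 1) = F i + F (i - 1) := by
    have h := hF (i + 1)
    rwa [show i + 1 - 1 = i by ring, show i + 1 - 2 = i - 1 by ring] at h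
  induction k using Int.induction_on with
  | zero =>
    have h := hF' 0
    rw [zero_add, hF0, hF1, zero_add, zero_sub] at h
    simp [hF0, hF1, ← h]
  | succ i ih =>
    have hf := hF' (i + 1)
    have hf' := hF' i
    rw [add_sub_cancel_right] at hf ⊢
    rw [hf, hf']
    rw [hf'] at ih
    linear_combination ih
  | pred i ih =>
    have hf := hF' (-i)
    have hf' := hF' (-i - 1)
    rw [sub_add_cancel] at hf' ⊢
    rw [hf, hf'] at ih
    rw [hf']
    linear_combination ih

/-- For all integers `j`, `k`, `s`,
`2 F_s F_k G_{j+k} G_{j+s} = F_s² G_{j+k}² + F_k² G_{j+s}² - F_{s-k}² G_j²`. -/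
theorem stmt_1 (F G : ℤ → ℤ)
    (hF0 : F 0 = 0) (hF1 : F 1 = 1)
    (hF : ∀ j : ℤ, F j = F (j - 1) + F (j - 2))
    (hG : ∀ j : ℤ, G j = G (j - 1) + G (j - 2))
    (j k s : ℤ) :
    2 * F s * F k * G (j + k) * G (j + s) =
      F s ^ 2 * G (j + k) ^ 2 + F k ^ 2 * G (j + s) ^ 2 - F (s - k) ^ 2 * G j ^ 2 := by
  have hs := fibonacciLike_add F G hF0 hF1 hF hG j s
  have hk := fibonacciLike_add F G hF0 hF1 hF hG j k
  have h₀ := fibonacciLike_add F F hF0 hF1 hF hF k (s - k)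
  have h₁ := fibonacciLike_add F F hF0 hF1 hF hF (k - 1) (s - k)
  rw [show k + (s - k) = s by ring] at h₀
  rw [show k - 1 + (s - k) = s - 1 by ring, sub_add_cancel] at h₁
  have hd : F s * G (j + k) - F k * G (j + s) =
      F (s - k) * G j * (F (k + 1) * F (k - 1) - F k ^ 2) := by
    rw [hs, hk, h₁, h₀]
    ring
  have hsq := congrArg (· ^ 2) hd
  simp only [mul_pow _ (F (k + 1) * F (k - 1) - F k ^ 2),
    fibonacci_cassini_sq F hF0 hF1 hF k] at hsq
  linear_combination -hsq
end

section
/- For every non-negative integer n and every real number x, (x³ − 2x² − 2x + 1)·∑_{j=0}^{n} x^j G_j² = −(2x² + 2x − 1)·G_0² − (2x² − x)·G_1² + x²·G_2² + (2x² + 2x − 1)·x^{n+1}·G_{n+1}² + (2x − 1)·x^{n+2}·G_{n+2}² − x^{n+3}·G_{n+3}². -/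
/-- The squares of a Fibonacci-like sequence satisfy a third-order linear recurrence. -/
theorem sq_add_three_of_fib_rec (G : ℤ → ℤ)
    (hG : ∀ j : ℤ, G j = G (j - 1) + G (j - 2)) (k : ℤ) :
    (G (k + 3) : ℝ) ^ 2 =
      2 * (G (k + 2) : ℝ) ^ 2 + 2 * (G (k + 1) : ℝ) ^ 2 - (G k : ℝ) ^ 2 := by
  have h₃ : G (k + 3) = G (k + 2) + G (k + 1) := by
    rw [hG (k + 3)]
    ring_nf
  have h₂ : G (k + 2) = G (k + 1) + G k := by
    rw [hG (k + 2)]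
    ring_nf
  rw [h₃, h₂]
  push_cast
  ring

/-- For every non-negative integer `n` and real `x`,
`(x³ - 2x² - 2x + 1) ∑_{j=0}^n x^j G_j² = -(2x² + 2x - 1) G_0² - (2x² - x) G_1² + x² G_2²
  + (2x² + 2x - 1) x^{n+1} G_{n+1}² + (2x - 1) x^{n+2} G_{n+2}² - x^{n+3} G_{n+3}²`. -/
theorem stmt_2 (G : ℤ → ℤ)
    (hG : ∀ j : ℤ, G j = G (j - 1) + G (j - 2))
    (n : ℕ) (x : ℝ) :
    (x ^ 3 - 2 * x ^ 2 - 2 * x + 1) * ∑ j ∈ Finset.range (n + 1), x ^ j * (G j : ℝ) ^ 2 =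
      -(2 * x ^ 2 + 2 * x - 1) * (G 0 : ℝ) ^ 2 - (2 * x ^ 2 - x) * (G 1 : ℝ) ^ 2
      + x ^ 2 * (G 2 : ℝ) ^ 2
      + (2 * x ^ 2 + 2 * x - 1) * x ^ (n + 1) * (G ((n : ℤ) + 1) : ℝ) ^ 2
      + (2 * x - 1) * x ^ (n + 2) * (G ((n : ℤ) + 2) : ℝ) ^ 2
      - x ^ (n + 3) * (G ((n : ℤ) + 3) : ℝ) ^ 2 := by
  induction n with
  | zero =>
    have h := sq_add_three_of_fib_rec G hG 0
    simp only [zero_add] at h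
    simp only [zero_add, Finset.sum_range_one, Nat.cast_zero, h]
    ring
  | succ n ih =>
    have h := sq_add_three_of_fib_rec G hG ((n : ℤ) + 1)
    have e₁ : (n : ℤ) + 1 + 1 = n + 2 := by ring
    have e₂ : (n : ℤ) + 1 + 2 = n + 3 := by ring
    rw [e₁, e₂] at h
    rw [Finset.sum_range_succ, mul_add, ih]
    push_cast
    rw [e₁, e₂, h]
    ring
end

section
/- For every non-negative integer n and every real number x, (1 − 2x − 2x² + x³)·∑_{j=0}^{n} x^j F_j² = x(1 − x) − (1 − 2x − 2x²)·x^{n+1}·F_{n+1}² − (1 − 2x)·x^{n+2}·F_{n+2}² − x^{n+3}·F_{n+3}². -/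
/-- For every non-negative integer `n` and real `x`,
`(1 - 2x - 2x² + x³) ∑_{j=0}^n x^j F_j² = x(1 - x)
  - (1 - 2x - 2x²) x^{n+1} F_{n+1}² - (1 - 2x) x^{n+2} F_{n+2}² - x^{n+3} F_{n+3}²`. -/
theorem stmt_4 (F : ℤ → ℤ)
    (hF0 : F 0 = 0) (hF1 : F 1 = 1)
    (hF : ∀ j : ℤ, F j = F (j - 1) + F (j - 2))
    (n : ℕ) (x : ℝ) :
    (1 - 2 * x - 2 * x ^ 2 + x ^ 3) * ∑ j ∈ Finset.range (n + 1), x ^ j * (F j : ℝ) ^ 2 =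
      x * (1 - x)
      - (1 - 2 * x - 2 * x ^ 2) * x ^ (n + 1) * (F ((n : ℤ) + 1) : ℝ) ^ 2
      - (1 - 2 * x) * x ^ (n + 2) * (F ((n : ℤ) + 2) : ℝ) ^ 2
      - x ^ (n + 3) * (F ((n : ℤ) + 3) : ℝ) ^ 2 := by
  have hrec (j : ℤ) : (F (j + 2) : ℝ) = F (j + 1) + F j := by
    have h := hF (j + 2)
    rw [show j + 2 - 1 = j + 1 by ring, show j + 2 - 2 = j by ring] at h
    exact_mod_cast h
  induction n with
  | zero =>
    have h2 := hrec 0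
    have h3 := hrec 1
    norm_num [hF0, hF1] at h2 h3 ⊢
    rw [h3, h2]
    ring
  | succ n ih =>
    have h3 := hrec ((n : ℤ) + 1)
    have h4 := hrec ((n : ℤ) + 2)
    simp only [add_assoc] at h3 h4
    norm_num at h3 h4
    rw [Finset.sum_range_succ, mul_add, ih]
    push_cast
    simp only [add_assoc]
    norm_num
    rw [h4, h3]
    ring
end

section
/- For every non-negative integer n, 5·(−1)^{n−1}·∑_{j=0}^{n} (−1)^j F_j² = (n+3)·F_{n+3}² − (3n+8)·F_{n+2}² + (n−1)·F_{n+1}² + 3·(−1)^{n−1}. -/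
/-- For every non-negative integer `n`,
`5 (-1)^{n-1} ∑_{j=0}^n (-1)^j F_j² = (n+3) F_{n+3}² - (3n+8) F_{n+2}² + (n-1) F_{n+1}²
  + 3 (-1)^{n-1}`.  (Note `(-1)^{n-1} = (-1)^{n+1}`.) -/
theorem stmt_6 (F : ℤ → ℤ)
    (hF0 : F 0 = 0) (hF1 : F 1 = 1)
    (hF : ∀ j : ℤ, F j = F (j - 1) + F (j - 2))
    (n : ℕ) :
    5 * (-1 : ℤ) ^ (n + 1) * ∑ j ∈ Finset.range (n + 1), (-1 : ℤ) ^ j * F j ^ 2 =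
      ((n : ℤ) + 3) * F ((n : ℤ) + 3) ^ 2 - (3 * (n : ℤ) + 8) * F ((n : ℤ) + 2) ^ 2
      + ((n : ℤ) - 1) * F ((n : ℤ) + 1) ^ 2 + 3 * (-1 : ℤ) ^ (n + 1) := by
  induction n with
  | zero =>
    have h2 : F 2 = 1 := by simpa [hF0, hF1] using hF 2
    have h3 : F 3 = 2 := by simpa [hF1, h2] using hF 3
    simp [hF0, hF1, h2, h3]
  | succ n ih =>
    have h3 : F ((n : ℤ) + 3) = F ((n : ℤ) + 2) + F ((n : ℤ) + 1) := by
      rw [hF]; ring_nf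
    have h4 : F ((n : ℤ) + 4) = F ((n : ℤ) + 3) + F ((n : ℤ) + 2) := by
      rw [hF]; ring_nf
    have hsq : (-1 : ℤ) ^ (n + 1) * (-1 : ℤ) ^ (n + 1) = 1 := by
      rw [← mul_pow]; simp
    rw [Finset.sum_range_succ, pow_succ _ (n + 1)]
    push_cast
    rw [show (n : ℤ) + 1 + 3 = n + 4 by ring, show (n : ℤ) + 1 + 2 = n + 3 by ring,
      show (n : ℤ) + 1 + 1 = n + 2 by ring, h4, h3]
    rw [h3] at ih
    linear_combination -ih - 5 * F ((n : ℤ) + 1) ^ 2 * hsq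
end

section
/- For every non-negative integer n and every integer k, ∑_{j=0}^{n} G_{j+k}² = (F_{k+1}·F_{k−1} + F_k²)·(G_n·G_{n+1} − G_0·G_1 + G_0²) + F_{k−1}·F_k·(G_n − G_1 + G_0)·(G_n + G_1 − G_0) + F_{k+1}·F_k·(G_{n+1} − G_0)·(G_{n+1} + G_0). -/
/-- The addition formula for a sequence satisfying the Fibonacci recurrence over the integers. -/
theorem fibonacci_like_add (F G : ℤ → ℤ) (hF0 : F 0 = 0) (hF1 : F 1 = 1)
    (hF : ∀ j : ℤ, F j = F (j - 1) + F (j - 2))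
    (hG : ∀ j : ℤ, G j = G (j - 1) + G (j - 2)) (j k : ℤ) :
    G (j + k) = F (k - 1) * G j + F k * G (j + 1) := by
  suffices h : G (j + k) = F (k - 1) * G j + F k * G (j + 1) ∧
      G (j + k + 1) = F k * G j + F (k + 1) * G (j + 1) from h.1
  induction k using Int.induction_on with
  | zero =>
    have h := hF 1
    simp only [sub_self, hF0, hF1, show (1 : ℤ) - 2 = 0 - 1 by norm_num, zero_add] at h
    simp only [add_zero, zero_add, ← h, hF0, hF1, one_mul, zero_mul, and_self]
  | succ i ih =>
    obtain ⟨h₀, h₁⟩ := ih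
    have hf₁ := hF (i + 1)
    have hf₂ := hF (i + 1 + 1)
    have hg := hG (j + i + 1 + 1)
    ring_nf at h₀ h₁ hf₁ hf₂ hg ⊢
    constructor
    · linear_combination h₁
    · linear_combination hg + h₀ + h₁ - G j * hf₁ - G (1 + j) * hf₂
  | pred i ih =>
    obtain ⟨h₀, h₁⟩ := ih
    have hf₁ := hF (-i)
    have hf₂ := hF (-i + 1)
    have hg := hG (j + -i + 1)
    ring_nf at h₀ h₁ hf₁ hf₂ hg ⊢
    constructor
    · linear_combination h₁ - h₀ - hg + G j * hf₁ + G (1 + j) * hf₂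
    · linear_combination h₀


/-- For every non-negative integer `n` and integer `k`,
`∑_{j=0}^n G_{j+k}² = (F_{k+1} F_{k-1} + F_k²)(G_n G_{n+1} - G_0 G_1 + G_0²)
  + F_{k-1} F_k (G_n - G_1 + G_0)(G_n + G_1 - G_0)
  + F_{k+1} F_k (G_{n+1} - G_0)(G_{n+1} + G_0)`. -/
theorem stmt_7 (F G : ℤ → ℤ)
    (hF0 : F 0 = 0) (hF1 : F 1 = 1)
    (hF : ∀ j : ℤ, F j = F (j - 1) + F (j - 2))
    (hG : ∀ j : ℤ, G j = G (j - 1) + G (j - 2))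
    (n : ℕ) (k : ℤ) :
    ∑ j ∈ Finset.range (n + 1), G ((j : ℤ) + k) ^ 2 =
      (F (k + 1) * F (k - 1) + F k ^ 2) * (G n * G ((n : ℤ) + 1) - G 0 * G 1 + G 0 ^ 2)
      + F (k - 1) * F k * (G n - G 1 + G 0) * (G n + G 1 - G 0)
      + F (k + 1) * F k * (G ((n : ℤ) + 1) - G 0) * (G ((n : ℤ) + 1) + G 0) := by
  have hF' : F (k + 1) = F k + F (k - 1) := by
    have h := hF (k + 1)
    rwa [add_sub_cancel_right, show k + 1 - 2 = k - 1 by ring] at h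
  induction n with
  | zero =>
    have h := fibonacci_like_add F G hF0 hF1 hF hG 0 k
    simp only [zero_add] at h
    simp only [zero_add, Finset.sum_range_one, Nat.cast_zero, h, hF']
    ring
  | succ n ih =>
    have hG' : G ((n : ℤ) + 1 + 1) = G ((n : ℤ) + 1) + G n := by
      have h := hG ((n : ℤ) + 1 + 1)
      rwa [add_sub_cancel_right, show (n : ℤ) + 1 + 1 - 2 = n by ring] at h
    rw [Finset.sum_range_succ, ih, fibonacci_like_add F G hF0 hF1 hF hG ((n + 1 : ℕ) : ℤ) k]
    push_cast
    rw [hG', hF']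
    ring
end

section
/- For every real number x with |x| < (3−√5)/2, the series ∑_{j=0}^{∞} x^j F_j² converges and equals x(1 − x)/(1 − 2x − 2x² + x³). -/
open Real in
theorem hasSum_pow_mul_fib_sq {x : ℝ} (hx : |x| < (3 - √5) / 2) :
    HasSum (fun j : ℕ => x ^ j * (Nat.fib j : ℝ) ^ 2)
      (x * (1 - x) / (1 - 2 * x - 2 * x ^ 2 + x ^ 3)) := by
  have h5 : √5 ^ 2 = 5 := sq_sqrt (by norm_num)
  have h5_two : 2 < √5 := lt_sqrt_of_sq_lt (by norm_num)
  have hφ : goldenRatio ^ 2 = (3 + √5) / 2 := by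
    rw [goldenRatio_sq, goldenRatio]; ring
  have hψ : goldenConj ^ 2 = (3 - √5) / 2 := by
    rw [goldenConj_sq, goldenConj]; ring
  have hxφ : |x * ((3 + √5) / 2)| < 1 := by
    rw [abs_mul, abs_of_pos (a := (3 + √5) / 2) (by positivity)]
    nlinarith
  have hx_one : |x| < 1 := by linarith
  have hxψ : |x * ((3 - √5) / 2)| < 1 := by
    rw [abs_mul, abs_of_pos (a := (3 - √5) / 2) ((abs_nonneg x).trans_lt hx)]
    nlinarith [abs_nonneg x]
  have hsum := (((hasSum_geometric_of_abs_lt_one hxφ).add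
    (hasSum_geometric_of_abs_lt_one hxψ)).sub
    ((hasSum_geometric_of_abs_lt_one (r := -x) (by rwa [abs_neg])).mul_left 2)).div_const 5
  have hterm (j : ℕ) : x ^ j * (Nat.fib j : ℝ) ^ 2 =
      ((x * ((3 + √5) / 2)) ^ j + (x * ((3 - √5) / 2)) ^ j - 2 * (-x) ^ j) / 5 := by
    have hprod : goldenRatio ^ j * goldenConj ^ j = (-1) ^ j := by
      rw [← mul_pow, goldenRatio_mul_goldenConj]
    rw [coe_fib_eq, div_pow, h5, ← hφ, ← hψ, mul_pow, mul_pow, neg_pow x, ← hprod,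
      ← pow_mul, ← pow_mul, mul_comm 2 j, pow_mul, pow_mul]
    ring
  have hval : x * (1 - x) / (1 - 2 * x - 2 * x ^ 2 + x ^ 3) =
      ((1 - x * ((3 + √5) / 2))⁻¹ + (1 - x * ((3 - √5) / 2))⁻¹ - 2 * (1 - -x)⁻¹) / 5 := by
    have h₁ : 1 - x * ((3 + √5) / 2) ≠ 0 := (sub_pos.mpr (abs_lt.mp hxφ).2).ne'
    have h₂ : 1 - x * ((3 - √5) / 2) ≠ 0 := (sub_pos.mpr (abs_lt.mp hxψ).2).ne'
    have h₃ : 1 + x ≠ 0 := ne_of_gt <| by linarith [(abs_lt.mp hx_one).1]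
    have hprod : (1 - x * ((3 + √5) / 2)) * (1 - x * ((3 - √5) / 2)) = 1 - 3 * x + x ^ 2 := by
      linear_combination -x ^ 2 / 4 * h5
    have hpair : (1 - x * ((3 + √5) / 2))⁻¹ + (1 - x * ((3 - √5) / 2))⁻¹ =
        (2 - 3 * x) / (1 - 3 * x + x ^ 2) := by
      rw [inv_add_inv h₁ h₂, hprod]
      ring
    have hquad : 1 - 3 * x + x ^ 2 ≠ 0 := hprod ▸ mul_ne_zero h₁ h₂
    rw [hpair, sub_neg_eq_add,
      show 1 - 2 * x - 2 * x ^ 2 + x ^ 3 = (1 - 3 * x + x ^ 2) * (1 + x) by ring]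
    generalize hq : 1 - 3 * x + x ^ 2 = q at hquad ⊢
    field_simp
    rw [← hq]
    ring
  rw [funext hterm, hval]
  exact hsum

/-- Generating function of `F_j²`: for every real `x` with `|x| < (3 - √5)/2`,
the series `∑_{j=0}^∞ x^j F_j²` converges and equals `x(1-x)/(1 - 2x - 2x² + x³)`. -/
theorem stmt_8 (F : ℤ → ℤ)
    (hF0 : F 0 = 0) (hF1 : F 1 = 1)
    (hF : ∀ j : ℤ, F j = F (j - 1) + F (j - 2))
    (x : ℝ) (hx : |x| < (3 - Real.sqrt 5) / 2) :
    HasSum (fun j : ℕ => x ^ j * (F j : ℝ) ^ 2)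
      (x * (1 - x) / (1 - 2 * x - 2 * x ^ 2 + x ^ 3)) := by
  have hfib : ∀ n : ℕ, F n = Nat.fib n := by
    intro n
    induction n using Nat.twoStepInduction with
    | zero => simpa using hF0
    | one => simpa using hF1
    | more n ih₀ ih₁ =>
      rw [hF, Nat.fib_add_two, Nat.cast_add (Nat.fib n), ← ih₀, ← ih₁, add_comm (F n)]
      congr 2 <;> push_cast <;> ring
  simpa [hfib] using hasSum_pow_mul_fib_sq hx
end

section
/- For every non-negative integer n, every integer k and every real number x, writing S_{F,n}(x) = ∑_{j=0}^{n} x^j F_j², one has (1+x)·∑_{j=0}^{n} x^j G_{j+k}² = (1+x)·S_{F,n}(x)·(G_{k+1}² + x·G_k² + 2(1−x)·G_k·G_{k+1}) + (1+x)·(1 − x^{n+1}·F_n²)·(G_k² − 2·G_k·G_{k+1}) + (1 + (−1)^n·x^{n+1})·2·G_k·G_{k+1}. -/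
/-- A Fibonacci-like sequence is determined by two consecutive terms. -/
theorem fibLike_add_succ {F G : ℤ → ℤ} (hF0 : F 0 = 0) (hF1 : F 1 = 1)
    (hF : ∀ j : ℤ, F j = F (j - 1) + F (j - 2))
    (hG : ∀ j : ℤ, G j = G (j - 1) + G (j - 2)) (k : ℤ) (n : ℕ) :
    G (n + k) = F n * G (k + 1) + (F (n + 1) - F n) * G k ∧
      G (n + 1 + k) = F (n + 1) * G (k + 1) + F n * G k := by
  induction n with
  | zero => simp [hF0, hF1, add_comm]
  | succ m ih =>
    have h₁ := hF (m + 1 + 1)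
    have h₂ := hG (m + 1 + 1 + k)
    rw [show (m + 1 + 1 : ℤ) - 1 = m + 1 by ring, show (m + 1 + 1 : ℤ) - 2 = m by ring] at h₁
    rw [show (m + 1 + 1 + k : ℤ) - 1 = m + 1 + k by ring,
      show (m + 1 + 1 + k : ℤ) - 2 = m + k by ring] at h₂
    push_cast
    rw [h₂, h₁, ih.1, ih.2]
    constructor <;> ring

/-- Cassini's identity, expressed in two consecutive Fibonacci numbers. -/
theorem fib_cassini {F : ℤ → ℤ} (hF0 : F 0 = 0) (hF1 : F 1 = 1)
    (hF : ∀ j : ℤ, F j = F (j - 1) + F (j - 2)) (n : ℕ) :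
    F (n + 1) ^ 2 - F n ^ 2 - F n * F (n + 1) = (-1) ^ n := by
  induction n with
  | zero => simp [hF0, hF1]
  | succ m ih =>
    have h₁ := hF (m + 1 + 1)
    rw [show (m + 1 + 1 : ℤ) - 1 = m + 1 by ring, show (m + 1 + 1 : ℤ) - 2 = m by ring] at h₁
    push_cast
    rw [h₁, pow_succ (-1 : ℤ) m, ← ih]
    ring

/-- For every non-negative integer `n`, integer `k` and real `x`, with
`S_{F,n}(x) = ∑_{j=0}^n x^j F_j²`:
`(1+x) ∑_{j=0}^n x^j G_{j+k}² = (1+x) S_{F,n}(x) (G_{k+1}² + x G_k² + 2(1-x) G_k G_{k+1})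
  + (1+x)(1 - x^{n+1} F_n²)(G_k² - 2 G_k G_{k+1}) + (1 + (-1)^n x^{n+1}) 2 G_k G_{k+1}`. -/
theorem stmt_9 (F G : ℤ → ℤ)
    (hF0 : F 0 = 0) (hF1 : F 1 = 1)
    (hF : ∀ j : ℤ, F j = F (j - 1) + F (j - 2))
    (hG : ∀ j : ℤ, G j = G (j - 1) + G (j - 2))
    (n : ℕ) (k : ℤ) (x : ℝ) :
    (1 + x) * ∑ j ∈ Finset.range (n + 1), x ^ j * (G ((j : ℤ) + k) : ℝ) ^ 2 =
      (1 + x) * (∑ j ∈ Finset.range (n + 1), x ^ j * (F j : ℝ) ^ 2)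
        * ((G (k + 1) : ℝ) ^ 2 + x * (G k : ℝ) ^ 2
            + 2 * (1 - x) * (G k : ℝ) * (G (k + 1) : ℝ))
      + (1 + x) * (1 - x ^ (n + 1) * (F n : ℝ) ^ 2)
        * ((G k : ℝ) ^ 2 - 2 * (G k : ℝ) * (G (k + 1) : ℝ))
      + (1 + (-1 : ℝ) ^ n * x ^ (n + 1)) * 2 * (G k : ℝ) * (G (k + 1) : ℝ) := by
  induction n with
  | zero => simp [hF0]; ring
  | succ m ih =>
    have hadd : (G (m + 1 + k) : ℝ) = F (m + 1) * G (k + 1) + F m * G k := by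
      exact_mod_cast (fibLike_add_succ hF0 hF1 hF hG k m).2
    have hcas : (F (m + 1) : ℝ) ^ 2 - (F m : ℝ) ^ 2 - F m * F (m + 1) = (-1) ^ m := by
      exact_mod_cast fib_cassini hF0 hF1 hF m
    rw [Finset.sum_range_succ _ (m + 1), Finset.sum_range_succ _ (m + 1), mul_add, ih]
    push_cast
    rw [hadd, pow_succ (-1 : ℝ) m, ← hcas]
    ring
end

section
/- For every non-negative integer n and every integer k, ∑_{j=0}^{n} F_{j+k}² = F_n·F_{n+1}·F_{2k+1} + (F_n² − 1)·F_{2k} + (1 + (−1)^n)·F_k·F_{k+1}. -/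
/-- The addition formula for a bi-infinite Fibonacci sequence. -/
theorem fib_int_add (F : ℤ → ℤ) (hF0 : F 0 = 0) (hF1 : F 1 = 1)
    (hF : ∀ j : ℤ, F (j + 2) = F (j + 1) + F j) (m k : ℤ) :
    F (m + k) = F m * F (k + 1) + (F (m + 1) - F m) * F k := by
  have key : F (m + k) = F m * F (k + 1) + (F (m + 1) - F m) * F k ∧
      F (m + k + 1) = F (m + 1) * F (k + 1) + F m * F k := by
    induction m using Int.induction_on with
    | zero => simp [hF0, hF1]
    | succ i ih =>
      obtain ⟨h1, h2⟩ := ih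
      have e1 := hF i
      have e2 := hF (i + k)
      rw [show (i : ℤ) + 1 + k = i + k + 1 by ring, show (i : ℤ) + 1 + 1 = i + 2 by ring,
        show (i : ℤ) + k + 1 + 1 = i + k + 2 by ring, e1, e2, h1, h2]
      constructor <;> ring
    | pred i ih =>
      obtain ⟨h1, h2⟩ := ih
      have e1 := hF (-i - 1)
      have e2 := hF (-i - 1 + k)
      rw [show -(i : ℤ) - 1 + 2 = -i + 1 by ring, show -(i : ℤ) - 1 + 1 = -i by ring] at e1
      rw [show -(i : ℤ) - 1 + k + 2 = -i + k + 1 by ring,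
        show -(i : ℤ) - 1 + k + 1 = -i + k by ring] at e2
      rw [show -(i : ℤ) - 1 + k + 1 = -i + k by ring, show -(i : ℤ) - 1 + 1 = -i by ring]
      constructor
      · linear_combination h2 - h1 - e2 + (F (k + 1) - F k) * e1
      · linear_combination h1 + F k * e1
  exact key.1

/-- Cassini's identity for a Fibonacci sequence. -/
theorem fib_int_cassini (F : ℤ → ℤ) (hF0 : F 0 = 0) (hF1 : F 1 = 1)
    (hF : ∀ j : ℤ, F (j + 2) = F (j + 1) + F j) (n : ℕ) :
    F (n + 1) ^ 2 - F n * F (n + 1) - F n ^ 2 = (-1) ^ n := by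
  induction n with
  | zero => simp [hF0, hF1]
  | succ n ih =>
    push_cast
    rw [show (n : ℤ) + 1 + 1 = n + 2 by ring, hF n, pow_succ]
    linear_combination -ih

/-- For every non-negative integer `n` and integer `k`,
`∑_{j=0}^n F_{j+k}² = F_n F_{n+1} F_{2k+1} + (F_n² - 1) F_{2k} + (1 + (-1)^n) F_k F_{k+1}`. -/
theorem stmt_11 (F : ℤ → ℤ)
    (hF0 : F 0 = 0) (hF1 : F 1 = 1)
    (hF : ∀ j : ℤ, F j = F (j - 1) + F (j - 2))
    (n : ℕ) (k : ℤ) :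
    ∑ j ∈ Finset.range (n + 1), F ((j : ℤ) + k) ^ 2 =
      F n * F ((n : ℤ) + 1) * F (2 * k + 1)
      + (F n ^ 2 - 1) * F (2 * k)
      + (1 + (-1 : ℤ) ^ n) * F k * F (k + 1) := by
  have hrec : ∀ j : ℤ, F (j + 2) = F (j + 1) + F j := fun j => by
    rw [hF (j + 2), show j + 2 - 1 = j + 1 by ring, show j + 2 - 2 = j by ring]
  have hadd := fib_int_add F hF0 hF1 hrec
  have hdouble : F (2 * k) = 2 * F k * F (k + 1) - F k ^ 2 := by
    rw [two_mul, hadd k k]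
    ring
  have hdouble_succ : F (2 * k + 1) = F k ^ 2 + F (k + 1) ^ 2 := by
    rw [show 2 * k + 1 = k + 1 + k by ring, hadd (k + 1) k,
      show k + 1 + 1 = k + 2 by ring, hrec k]
    ring
  rw [hdouble, hdouble_succ]
  induction n with
  | zero =>
    simp [hF0, hF1]
  | succ n ih =>
    have hcassini := fib_int_cassini F hF0 hF1 hrec n
    rw [Finset.sum_range_succ, ih]
    push_cast
    rw [hadd (n + 1) k, show (n : ℤ) + 1 + 1 = n + 2 by ring, hrec n]
    linear_combination -2 * F k * F (k + 1) * hcassini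
end

section
/- For every non-negative integer n and every real number x, writing S_{G,n}(x) = ∑_{j=0}^{n} x^j G_j², one has ∑_{j=0}^{n} x^j G_{j+1}·G_{j−2} = (1 − x)·S_{G,n}(x) + x^{n+1}·G_n² − (G_1 − G_0)². -/
/-- For every non-negative integer `n` and real `x`, with `S_{G,n}(x) = ∑_{j=0}^n x^j G_j²`:
`∑_{j=0}^n x^j G_{j+1} G_{j-2} = (1 - x) S_{G,n}(x) + x^{n+1} G_n² - (G_1 - G_0)²`. -/
theorem stmt_14 (G : ℤ → ℤ)
    (hG : ∀ j : ℤ, G j = G (j - 1) + G (j - 2))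
    (n : ℕ) (x : ℝ) :
    ∑ j ∈ Finset.range (n + 1), x ^ j * (G ((j : ℤ) + 1) : ℝ) * (G ((j : ℤ) - 2) : ℝ) =
      (1 - x) * ∑ j ∈ Finset.range (n + 1), x ^ j * (G j : ℝ) ^ 2
      + x ^ (n + 1) * (G n : ℝ) ^ 2 - ((G 1 : ℝ) - (G 0 : ℝ)) ^ 2 := by
  have key (j : ℤ) : (G (j + 1) : ℝ) * G (j - 2) = (G j : ℝ) ^ 2 - (G (j - 1) : ℝ) ^ 2 := by
    have h₁ := hG (j + 1)
    have h₂ := hG j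
    rw [show j + 1 - 1 = j by ring, show j + 1 - 2 = j - 1 by ring] at h₁
    rw [h₁, show G (j - 2) = G j - G (j - 1) by linarith]
    push_cast
    ring
  induction n with
  | zero =>
    have h := hG 1
    norm_num at h
    have hk := key 0
    norm_num at hk
    simp [hk, show (G 1 : ℝ) - G 0 = G (-1) by rw [h]; push_cast; ring]
    ring
  | succ n ih =>
    rw [Finset.sum_range_succ, ih, Finset.sum_range_succ _ (n + 1), mul_assoc, key]
    push_cast
    rw [add_sub_cancel_right]
    ring
end

section
/- For every non-negative integer n and every real number x, writing S_{G,n}(x) = ∑_{j=0}^{n} x^j G_j², one has 2x·∑_{j=0}^{n} x^j G_j·G_{j−1} = (1 − x − x²)·S_{G,n}(x) + x^{n+1}·G_{n+1}² + x^{n+2}·G_n² − x·(G_1 − G_0)² − G_0². -/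
/-- For every non-negative integer `n` and real `x`, with `S_{G,n}(x) = ∑_{j=0}^n x^j G_j²`:
`2x ∑_{j=0}^n x^j G_j G_{j-1} = (1 - x - x²) S_{G,n}(x) + x^{n+1} G_{n+1}² + x^{n+2} G_n²
  - x (G_1 - G_0)² - G_0²`. -/
theorem stmt_15 (G : ℤ → ℤ)
    (hG : ∀ j : ℤ, G j = G (j - 1) + G (j - 2))
    (n : ℕ) (x : ℝ) :
    2 * x * ∑ j ∈ Finset.range (n + 1), x ^ j * (G j : ℝ) * (G ((j : ℤ) - 1) : ℝ) =
      (1 - x - x ^ 2) * ∑ j ∈ Finset.range (n + 1), x ^ j * (G j : ℝ) ^ 2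
      + x ^ (n + 1) * (G ((n : ℤ) + 1) : ℝ) ^ 2 + x ^ (n + 2) * (G n : ℝ) ^ 2
      - x * ((G 1 : ℝ) - (G 0 : ℝ)) ^ 2 - (G 0 : ℝ) ^ 2 := by
  have h_succ (j : ℤ) : (G (j + 1) : ℝ) = G j + G (j - 1) := by
    have h := hG (j + 1)
    rw [show j + 1 - 1 = j by ring, show j + 1 - 2 = j - 1 by ring] at h
    exact_mod_cast h
  induction n with
  | zero =>
    have h := h_succ 0
    simp only [zero_add, zero_sub] at h
    simp [h]
    ring
  | succ n ih =>
    rw [Finset.sum_range_succ, Finset.sum_range_succ _ (n + 1), mul_add, ih]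
    have h := h_succ ((n : ℤ) + 1)
    rw [show (n : ℤ) + 1 - 1 = n by ring] at h
    push_cast
    rw [show (n : ℤ) + 1 - 1 = n by ring, h]
    ring
end

section
/- For every non-negative integer n, every integer k and every real number x, writing S_{G,n}(x) = ∑_{j=0}^{n} x^j G_j², one has (−1)^k · 2x · ∑_{j=0}^{n} x^j G_{j+k}·G_{j−k} = (x·L_k² − (1 + x²)·F_k² − 2x·F_{k−1}·F_{k+1})·S_{G,n}(x) + x·F_k²·(x^{n+1}·G_n² − G_0² − G_1² + 2·G_0·G_1) − F_k²·(x^{n+1}·G_{n+1}² − G_0²). -/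
/-- A sequence on `ℤ` with the Fibonacci recurrence and two zero initial values vanishes. -/
theorem fib_recurrence_eq_zero {R : Type*} [CommRing R] (A : ℤ → R) (h0 : A 0 = 0) (h1 : A 1 = 0)
    (h : ∀ k, A (k + 2) = A (k + 1) + A k) (k : ℤ) : A k = 0 := by
  have key : A k = 0 ∧ A (k + 1) = 0 := by
    induction k using Int.induction_on with
    | zero => exact ⟨h0, by simpa using h1⟩
    | succ i ih =>
      refine ⟨ih.2, ?_⟩
      rw [add_assoc, one_add_one_eq_two, h, ih.1, ih.2, add_zero]
    | pred i ih =>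
      have e := h (-(i : ℤ) - 1)
      rw [show -(i : ℤ) - 1 + 2 = -i + 1 by ring, sub_add_cancel, ih.1, ih.2, zero_add] at e
      exact ⟨e.symm, by rw [sub_add_cancel]; exact ih.1⟩
  exact key.1

theorem neg_one_pow_natAbs_add_one {R : Type*} [CommRing R] (k : ℤ) :
    (-1 : R) ^ (k + 1).natAbs = -(-1 : R) ^ k.natAbs := by
  rcases Int.even_or_odd k with hk | hk
  · rw [(Int.natAbs_even.2 hk).neg_one_pow, (Int.natAbs_odd.2 hk.add_one).neg_one_pow]
  · rw [(Int.natAbs_odd.2 hk).neg_one_pow, (Int.natAbs_even.2 hk.add_one).neg_one_pow, neg_neg]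

theorem fib_recurrence_shift {G : ℤ → ℤ}
    (hG : ∀ j : ℤ, G j = G (j - 1) + G (j - 2)) (j : ℤ) :
    G (j + 2) = G (j + 1) + G j := by
  have := hG (j + 2)
  rwa [show j + 2 - 1 = j + 1 by ring, show j + 2 - 2 = j by ring] at this

theorem lucas_eq_fib_add_fib {F L : ℤ → ℤ} (hF0 : F 0 = 0) (hF1 : F 1 = 1)
    (hF : ∀ j : ℤ, F j = F (j - 1) + F (j - 2))
    (hL0 : L 0 = 2) (hL1 : L 1 = 1)
    (hL : ∀ j : ℤ, L j = L (j - 1) + L (j - 2)) (k : ℤ) :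
    L k = F (k - 1) + F (k + 1) := by
  have hm := hF 1
  have h2 := hF 2
  norm_num [hF0, hF1] at hm h2
  rw [← sub_eq_zero]
  refine fib_recurrence_eq_zero (fun k => L k - (F (k - 1) + F (k + 1))) ?_ ?_ (fun k => ?_) k
  · norm_num [hL0, hF1]
    linarith
  · norm_num [hL1, hF0, h2]
  · have a := fib_recurrence_shift hL k
    have b := fib_recurrence_shift hF (k - 1)
    have c := fib_recurrence_shift hF (k + 1)
    ring_nf at a b c ⊢
    linarith

theorem fib_like_add {F G : ℤ → ℤ} (hF0 : F 0 = 0) (hF1 : F 1 = 1)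
    (hF : ∀ j : ℤ, F j = F (j - 1) + F (j - 2))
    (hG : ∀ j : ℤ, G j = G (j - 1) + G (j - 2)) (j k : ℤ) :
    G (j + k) = F k * G (j + 1) + F (k - 1) * G j := by
  have hm := hF 1
  norm_num [hF0, hF1] at hm
  rw [← sub_eq_zero]
  refine fib_recurrence_eq_zero
    (fun k => G (j + k) - (F k * G (j + 1) + F (k - 1) * G j)) ?_ ?_ (fun k => ?_) k
  · norm_num [hF0, ← hm]
  · norm_num [hF0, hF1]
  · have a := fib_recurrence_shift hG (j + k)
    have b := fib_recurrence_shift hF (k - 1)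
    have c := fib_recurrence_shift hF k
    rw [show k - 1 + 2 = k + 2 - 1 by ring, show k - 1 + 1 = k + 1 - 1 by ring] at b
    simp only [← add_assoc, a, b, c]
    ring

theorem fib_like_sub {F G : ℤ → ℤ} (hF0 : F 0 = 0) (hF1 : F 1 = 1)
    (hF : ∀ j : ℤ, F j = F (j - 1) + F (j - 2))
    (hG : ∀ j : ℤ, G j = G (j - 1) + G (j - 2)) (j k : ℤ) :
    (-1) ^ k.natAbs * G (j - k) = F (k + 1) * G j - F k * G (j + 1) := by
  have h2 := hF 2
  norm_num [hF0, hF1] at h2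
  rw [← sub_eq_zero]
  refine fib_recurrence_eq_zero
    (fun k => (-1) ^ k.natAbs * G (j - k) - (F (k + 1) * G j - F k * G (j + 1)))
    ?_ ?_ (fun k => ?_) k
  · norm_num [hF0, hF1]
  · have := hG (j + 1)
    rw [show j + 1 - 1 = j by ring, show j + 1 - 2 = j - 1 by ring] at this
    norm_num [hF1, h2]
    linarith
  · have a := hG (j - k)
    have b := fib_recurrence_shift hF (k + 1)
    have c := fib_recurrence_shift hF k
    have e : (-1 : ℤ) ^ (k + 2).natAbs = (-1) ^ k.natAbs := by
      rw [show k + 2 = k + 1 + 1 by ring, neg_one_pow_natAbs_add_one, neg_one_pow_natAbs_add_one,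
        neg_neg]
    rw [show k + 1 + 2 = k + 2 + 1 by ring] at b
    simp only [e, neg_one_pow_natAbs_add_one, b, c, a, ← sub_sub,
      show j - (k + 2) = j - k - 2 by ring, show k + 1 + 1 = k + 2 by ring]
    ring

theorem two_mul_fib_like_add_mul_sub {F G : ℤ → ℤ} (hF0 : F 0 = 0) (hF1 : F 1 = 1)
    (hF : ∀ j : ℤ, F j = F (j - 1) + F (j - 2))
    (hG : ∀ j : ℤ, G j = G (j - 1) + G (j - 2)) (j k : ℤ) :
    (-1) ^ k.natAbs * 2 * (G (j + k) * G (j - k)) =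
      F k ^ 2 * (G j ^ 2 - G (j + 1) ^ 2 - G (j - 1) ^ 2)
        + 2 * F (k - 1) * F (k + 1) * G j ^ 2 := by
  have a := fib_like_add hF0 hF1 hF hG j k
  have b := fib_like_sub hF0 hF1 hF hG j k
  have c := hF (k + 1)
  have d := hG (j + 1)
  rw [show k + 1 - 1 = k by ring, show k + 1 - 2 = k - 1 by ring] at c
  rw [show j + 1 - 1 = j by ring, show j + 1 - 2 = j - 1 by ring] at d
  calc _ = 2 * G (j + k) * ((-1) ^ k.natAbs * G (j - k)) := by ring
    _ = _ := by
      rw [a, b, c, d]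
      ring


/-- For every non-negative integer `n`, integer `k` and real `x`, with
`S_{G,n}(x) = ∑_{j=0}^n x^j G_j²`:
`(-1)^k 2x ∑_{j=0}^n x^j G_{j+k} G_{j-k}
  = (x L_k² - (1 + x²) F_k² - 2x F_{k-1} F_{k+1}) S_{G,n}(x)
  + x F_k² (x^{n+1} G_n² - G_0² - G_1² + 2 G_0 G_1) - F_k² (x^{n+1} G_{n+1}² - G_0²)`. -/
theorem stmt_16 (F L G : ℤ → ℤ)
    (hF0 : F 0 = 0) (hF1 : F 1 = 1)
    (hF : ∀ j : ℤ, F j = F (j - 1) + F (j - 2))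
    (hL0 : L 0 = 2) (hL1 : L 1 = 1)
    (hL : ∀ j : ℤ, L j = L (j - 1) + L (j - 2))
    (hG : ∀ j : ℤ, G j = G (j - 1) + G (j - 2))
    (n : ℕ) (k : ℤ) (x : ℝ) :
    (-1 : ℝ) ^ k.natAbs * 2 * x
        * ∑ j ∈ Finset.range (n + 1), x ^ j * (G ((j : ℤ) + k) : ℝ) * (G ((j : ℤ) - k) : ℝ) =
      (x * (L k : ℝ) ^ 2 - (1 + x ^ 2) * (F k : ℝ) ^ 2
          - 2 * x * (F (k - 1) : ℝ) * (F (k + 1) : ℝ))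
        * ∑ j ∈ Finset.range (n + 1), x ^ j * (G j : ℝ) ^ 2
      + x * (F k : ℝ) ^ 2
        * (x ^ (n + 1) * (G n : ℝ) ^ 2 - (G 0 : ℝ) ^ 2 - (G 1 : ℝ) ^ 2
            + 2 * (G 0 : ℝ) * (G 1 : ℝ))
      - (F k : ℝ) ^ 2 * (x ^ (n + 1) * (G ((n : ℤ) + 1) : ℝ) ^ 2 - (G 0 : ℝ) ^ 2) := by
  have hLk : (L k : ℝ) = F (k - 1) + F (k + 1) := by
    exact_mod_cast lucas_eq_fib_add_fib hF0 hF1 hF hL0 hL1 hL k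
  have hFk : (F (k + 1) : ℝ) = F k + F (k - 1) := by
    have := hF (k + 1)
    rw [show k + 1 - 1 = k by ring, show k + 1 - 2 = k - 1 by ring] at this
    exact_mod_cast this
  have key (j : ℤ) : (-1 : ℝ) ^ k.natAbs * 2 * (G (j + k) * G (j - k)) =
      F k ^ 2 * (G j ^ 2 - G (j + 1) ^ 2 - G (j - 1) ^ 2)
        + 2 * F (k - 1) * F (k + 1) * G j ^ 2 := by
    exact_mod_cast two_mul_fib_like_add_mul_sub hF0 hF1 hF hG j k
  rw [hLk]
  induction n with
  | zero =>
    have h := key 0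
    have hm : (G 1 : ℝ) = G 0 + G (0 - 1) := by exact_mod_cast hG 1
    have hm' : (G (0 - 1) : ℝ) = G 1 - G 0 := by linarith
    rw [hm', zero_add 1] at h
    simp only [zero_add, Finset.sum_range_one, pow_zero, pow_one, one_mul, Nat.cast_zero] at h ⊢
    rw [hFk] at h ⊢
    linear_combination x * h
  | succ n ih =>
    have h := key ((n : ℤ) + 1)
    rw [add_sub_cancel_right] at h
    rw [Finset.sum_range_succ, Finset.sum_range_succ _ (n + 1), mul_add, ih]
    push_cast
    rw [hFk] at h ⊢
    linear_combination x * x ^ (n + 1) * h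
end
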